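/- Let β = (√17 − 3)/2 and define h : [0,1] → ℝ by h(u) = (u(1−u))^{β/2}. Then for every x ∈ [0,1], (2/(β+1)) · ( ∫ₓ¹ u^β h(x/u) du + ∫₀ˣ (1−u)^β h((x−u)/(1−u)) du ) = h(x). -/

import Mathlib

open MeasureTheory Real

/-- The exponent `β = (√17 − 3)/2` of partial match queries in quadtrees. -/
noncomputable def quadBeta : ℝ := (Real.sqrt 17 - 3) / 2

/-- The function `h(u) = (u(1−u))^{β/2}`. -/
noncomputable def quadH (u : ℝ) : ℝ := (u * (1 - u)) ^ (quadBeta / 2)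

lemma quadBeta_pos : 0 < quadBeta := by
  have h : (3 : ℝ) < √17 := Real.lt_sqrt_of_sq_lt (by norm_num)
  unfold quadBeta
  linarith

lemma quadBeta_add_one_mul_add_two : (quadBeta + 1) * (quadBeta + 2) = 4 := by
  have h : √17 ^ 2 = (17 : ℝ) := Real.sq_sqrt (by norm_num)
  unfold quadBeta
  linear_combination h / 4

lemma quadH_one_sub (u : ℝ) : quadH (1 - u) = quadH u := by
  unfold quadH
  congr 1
  ring

lemma rpow_mul_quadH_div {x u : ℝ} (hx : 0 ≤ x) (hu : 0 < u) (hxu : x ≤ u) :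
    u ^ quadBeta * quadH (x / u) = x ^ (quadBeta / 2) * (u - x) ^ (quadBeta / 2) := by
  have hsq : u ^ quadBeta = (u ^ 2) ^ (quadBeta / 2) := by
    rw [← Real.rpow_natCast_mul hu.le]
    congr 1
    push_cast
    ring
  have hnonneg : 0 ≤ x / u * (1 - x / u) :=
    mul_nonneg (by positivity) (sub_nonneg.2 ((div_le_one hu).2 hxu))
  rw [quadH, hsq, ← Real.mul_rpow (by positivity) hnonneg,
    ← Real.mul_rpow hx (sub_nonneg.2 hxu)]
  congr 1
  field_simp

lemma integral_rpow_mul_quadH_div {x : ℝ} (hx : x ∈ Set.Icc (0 : ℝ) 1) :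
    ∫ u in x..1, u ^ quadBeta * quadH (x / u) = quadH x * (1 - x) / (quadBeta / 2 + 1) := by
  have hβ := quadBeta_pos
  have h1x : 0 ≤ 1 - x := sub_nonneg.2 hx.2
  have hcongr : ∫ u in x..1, u ^ quadBeta * quadH (x / u)
      = ∫ u in x..1, x ^ (quadBeta / 2) * (u - x) ^ (quadBeta / 2) := by
    refine intervalIntegral.integral_congr_ae (.of_forall fun u hu => ?_)
    rw [Set.uIoc_of_le hx.2] at hu
    exact rpow_mul_quadH_div hx.1 (hx.1.trans_lt hu.1) hu.1.le
  rw [hcongr, intervalIntegral.integral_const_mul,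
    intervalIntegral.integral_comp_sub_right (fun u => u ^ (quadBeta / 2)), sub_self,
    integral_rpow (Or.inl (by linarith)), Real.zero_rpow (by linarith),
    Real.rpow_add_one' h1x (by linarith), quadH, Real.mul_rpow hx.1 h1x]
  ring

lemma integral_one_sub_rpow_mul_quadH_div (x : ℝ) :
    ∫ u in (0 : ℝ)..x, (1 - u) ^ quadBeta * quadH ((x - u) / (1 - u))
      = ∫ u in (1 - x)..1, u ^ quadBeta * quadH ((1 - x) / u) := by
  have hsub := intervalIntegral.integral_comp_sub_left (a := 0) (b := x)
    (fun u => u ^ quadBeta * quadH ((1 - x) / u)) 1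
  rw [sub_zero] at hsub
  rw [← hsub]
  refine intervalIntegral.integral_congr fun u _ => ?_
  rcases eq_or_ne (1 - u) 0 with hu | hu
  · simp [hu]
  · have hdiv : (x - u) / (1 - u) = 1 - (1 - x) / (1 - u) := by
      field_simp
      ring
    simp only [hdiv, quadH_one_sub]

/-- The one-dimensional integral identity satisfied by `(β, h)`, obtained from the
two-dimensional dislocation identity by integrating out the second coordinate. -/
theorem quadtree_malthusian_one_dim (x : ℝ) (hx : x ∈ Set.Icc (0 : ℝ) 1) :
    (2 / (quadBeta + 1))
      * ((∫ u in x..1, u ^ quadBeta * quadH (x / u))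
          + (∫ u in (0 : ℝ)..x, (1 - u) ^ quadBeta * quadH ((x - u) / (1 - u))))
      = quadH x := by
  have hβ := quadBeta_pos
  rw [integral_one_sub_rpow_mul_quadH_div, integral_rpow_mul_quadH_div hx,
    integral_rpow_mul_quadH_div (Set.Icc.mem_iff_one_sub_mem.1 hx), quadH_one_sub]
  field_simp
  linear_combination -quadH x * quadBeta_add_one_mul_add_two
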